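/- Let V be any non-zero 𝔤₀-supermodule. Then every non-zero 𝔤₋₁-submodule of the Kac module K(V) has non-zero intersection with Λ^max(𝔤₋₁) ⊗ V; in particular, the space of 𝔤₋₁-invariants of K(V) equals Λ^max(𝔤₋₁) ⊗ V. -/

import Mathlib

noncomputable section

open Module Function

/-- A complex Lie superalgebra `𝔤 = 𝔤₀̄ ⊕ 𝔤₁̄` equipped with a compatible `ℤ`-grading
`𝔤 = 𝔤₋₁ ⊕ 𝔤₀ ⊕ 𝔤₁`, i.e. `𝔤₀ = 𝔤₀̄`, `𝔤₁̄ = 𝔤₁ ⊕ 𝔤₋₁`, the pieces `𝔤±₁` are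
`𝔤₀̄`-submodules and `[𝔤₁,𝔤₁] = [𝔤₋₁,𝔤₋₁] = 0`.  The super skew-symmetry and the super
Jacobi identity are imposed on (parity-)homogeneous elements, as usual. -/
structure GLSA where
  carrier : Type
  [isACG : AddCommGroup carrier]
  [isMod : Module ℂ carrier]
  bracket : carrier →ₗ[ℂ] carrier →ₗ[ℂ] carrier
  gneg : Submodule ℂ carrier
  g0 : Submodule ℂ carrier
  gpos : Submodule ℂ carrier
  oddCompl : IsCompl g0 (gneg ⊔ gpos)
  disjNP : Disjoint gneg gpos
  br_00 : ∀ x ∈ g0, ∀ y ∈ g0, bracket x y ∈ g0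
  br_0p : ∀ x ∈ g0, ∀ y ∈ gpos, bracket x y ∈ gpos
  br_0n : ∀ x ∈ g0, ∀ y ∈ gneg, bracket x y ∈ gneg
  br_pn : ∀ x ∈ gpos, ∀ y ∈ gneg, bracket x y ∈ g0
  br_pp : ∀ x ∈ gpos, ∀ y ∈ gpos, bracket x y = 0
  br_nn : ∀ x ∈ gneg, ∀ y ∈ gneg, bracket x y = 0
  skew_e : ∀ x ∈ g0, ∀ y, bracket x y = - bracket y x
  skew_oo : ∀ x ∈ gneg ⊔ gpos, ∀ y ∈ gneg ⊔ gpos, bracket x y = bracket y x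
  jacobi_e : ∀ x y z : carrier, (x ∈ g0 ∨ y ∈ g0) →
    bracket x (bracket y z) = bracket (bracket x y) z + bracket y (bracket x z)
  jacobi_oo : ∀ x ∈ gneg ⊔ gpos, ∀ y ∈ gneg ⊔ gpos, ∀ z,
    bracket x (bracket y z) = bracket (bracket x y) z - bracket y (bracket x z)

attribute [instance] GLSA.isACG GLSA.isMod

/-- The odd part `𝔤₁̄ = 𝔤₋₁ ⊕ 𝔤₁` of `L`. -/
def GLSA.odd (L : GLSA) : Submodule ℂ L.carrier := L.gneg ⊔ L.gpos

/-- A `𝔤`-supermodule: a `ℤ₂`-graded complex vector space with a compatible action of the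
Lie superalgebra `L` (signs in the compatibility with the bracket are imposed on
homogeneous elements). -/
structure SMod (L : GLSA) where
  carrier : Type
  [isACG : AddCommGroup carrier]
  [isMod : Module ℂ carrier]
  act : L.carrier →ₗ[ℂ] carrier →ₗ[ℂ] carrier
  ev : Submodule ℂ carrier
  od : Submodule ℂ carrier
  grading : IsCompl ev od
  act_e_ev : ∀ x ∈ L.g0, ∀ m ∈ ev, act x m ∈ ev
  act_e_od : ∀ x ∈ L.g0, ∀ m ∈ od, act x m ∈ od
  act_o_ev : ∀ x ∈ L.odd, ∀ m ∈ ev, act x m ∈ od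
  act_o_od : ∀ x ∈ L.odd, ∀ m ∈ od, act x m ∈ ev
  act_br_e : ∀ x y : L.carrier, (x ∈ L.g0 ∨ y ∈ L.g0) → ∀ m,
    act (L.bracket x y) m = act x (act y m) - act y (act x m)
  act_br_oo : ∀ x ∈ L.odd, ∀ y ∈ L.odd, ∀ m,
    act (L.bracket x y) m = act x (act y m) + act y (act x m)

attribute [instance] SMod.isACG SMod.isMod

/-- A `𝔤₀̄`-supermodule: a `ℤ₂`-graded complex vector space with an action of the (purely
even) Lie algebra `𝔤₀̄ = 𝔤₀` preserving the grading. -/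
structure SMod0 (L : GLSA) where
  carrier : Type
  [isACG : AddCommGroup carrier]
  [isMod : Module ℂ carrier]
  act : ↥L.g0 →ₗ[ℂ] carrier →ₗ[ℂ] carrier
  ev : Submodule ℂ carrier
  od : Submodule ℂ carrier
  grading : IsCompl ev od
  act_ev : ∀ (x : L.g0), ∀ m ∈ ev, act x m ∈ ev
  act_od : ∀ (x : L.g0), ∀ m ∈ od, act x m ∈ od
  act_br : ∀ (x y : L.g0) (m : carrier),
    act ⟨L.bracket ↑x ↑y, L.br_00 ↑x x.2 ↑y y.2⟩ m = act x (act y m) - act y (act x m)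

attribute [instance] SMod0.isACG SMod0.isMod

/-- A homomorphism of `𝔤`-supermodules (homogeneous of degree zero). -/
structure SHom {L : GLSA} (M N : SMod L) where
  toLin : M.carrier →ₗ[ℂ] N.carrier
  map_ev : ∀ m ∈ M.ev, toLin m ∈ N.ev
  map_od : ∀ m ∈ M.od, toLin m ∈ N.od
  equivar : ∀ (x : L.carrier) (m : M.carrier), toLin (M.act x m) = N.act x (toLin m)

/-- Isomorphism of `𝔤`-supermodules. -/
def SIso {L : GLSA} (M N : SMod L) : Prop := ∃ f : SHom M N, Bijective f.toLin

/-- Isomorphism of `𝔤₀̄`-supermodules. -/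
def SIso0 {L : GLSA} (V W : SMod0 L) : Prop :=
  ∃ e : V.carrier ≃ₗ[ℂ] W.carrier,
    (∀ v ∈ V.ev, e v ∈ W.ev) ∧ (∀ v ∈ V.od, e v ∈ W.od) ∧
    (∀ (x : L.g0) (v : V.carrier), e (V.act x v) = W.act x (e v))

/-- Isomorphism of `𝔤`-supermodules up to parity change. -/
def SIsoUpToParity {L : GLSA} (M N : SMod L) : Prop :=
  ∃ e : M.carrier ≃ₗ[ℂ] N.carrier,
    (∀ (x : L.carrier) (m : M.carrier), e (M.act x m) = N.act x (e m)) ∧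
    (((∀ m ∈ M.ev, e m ∈ N.ev) ∧ (∀ m ∈ M.od, e m ∈ N.od)) ∨
     ((∀ m ∈ M.ev, e m ∈ N.od) ∧ (∀ m ∈ M.od, e m ∈ N.ev)))

namespace SMod

variable {L : GLSA}

/-- A (graded) sub-supermodule of a `𝔤`-supermodule. -/
def IsSubmod (M : SMod L) (N : Submodule ℂ M.carrier) : Prop :=
  (∀ (x : L.carrier), ∀ m ∈ N, M.act x m ∈ N) ∧ N ≤ (N ⊓ M.ev) ⊔ (N ⊓ M.od)

/-- A simple sub-supermodule. -/
def IsSimpleSub (M : SMod L) (N : Submodule ℂ M.carrier) : Prop :=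
  M.IsSubmod N ∧ N ≠ ⊥ ∧ ∀ N', M.IsSubmod N' → N' ≤ N → N' = ⊥ ∨ N' = N

/-- The socle: the sum of all simple sub-supermodules. -/
def socle (M : SMod L) : Submodule ℂ M.carrier := sSup {N | M.IsSimpleSub N}

/-- The sub-supermodule generated by a subspace, i.e. `U(𝔤)·S`. -/
def gen (M : SMod L) (S : Submodule ℂ M.carrier) : Submodule ℂ M.carrier :=
  sInf {N | M.IsSubmod N ∧ S ≤ N}

/-- Simplicity of a `𝔤`-supermodule. -/
def IsSimple (M : SMod L) : Prop :=
  (⊤ : Submodule ℂ M.carrier) ≠ ⊥ ∧ ∀ N, M.IsSubmod N → N = ⊥ ∨ N = ⊤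

/-- Indecomposability of a `𝔤`-supermodule. -/
def Indecomposable (M : SMod L) : Prop :=
  (⊤ : Submodule ℂ M.carrier) ≠ ⊥ ∧
  ∀ N₁ N₂, M.IsSubmod N₁ → M.IsSubmod N₂ → N₁ ⊓ N₂ = ⊥ → N₁ ⊔ N₂ = ⊤ →
    N₁ = ⊥ ∨ N₂ = ⊥

/-- The parity change functor `Π`. -/
def pshift (M : SMod L) : SMod L where
  carrier := M.carrier
  act := M.act
  ev := M.od
  od := M.ev
  grading := M.grading.symm
  act_e_ev := M.act_e_od
  act_e_od := M.act_e_ev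
  act_o_ev := M.act_o_od
  act_o_od := M.act_o_ev
  act_br_e := M.act_br_e
  act_br_oo := M.act_br_oo

/-- The space `M^{𝔤₁}` of `𝔤₁`-invariants. -/
def invPos (M : SMod L) : Submodule ℂ M.carrier where
  carrier := {m | ∀ x ∈ L.gpos, M.act x m = 0}
  add_mem' := by
    intro a b ha hb x hx
    rw [map_add, ha x hx, hb x hx, add_zero]
  zero_mem' := by intro x hx; simp
  smul_mem' := by
    intro c a ha x hx
    rw [map_smul, ha x hx, smul_zero]

/-- The space `M^{𝔤₋₁}` of `𝔤₋₁`-invariants. -/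
def invNeg (M : SMod L) : Submodule ℂ M.carrier where
  carrier := {m | ∀ x ∈ L.gneg, M.act x m = 0}
  add_mem' := by
    intro a b ha hb x hx
    rw [map_add, ha x hx, hb x hx, add_zero]
  zero_mem' := by intro x hx; simp
  smul_mem' := by
    intro c a ha x hx
    rw [map_smul, ha x hx, smul_zero]

/-- Iterated action of a list of elements of `𝔤`. -/
def actList (M : SMod L) : List L.carrier → M.carrier → M.carrier
  | [], m => m
  | x :: xs, m => M.act x (M.actList xs m)

end SMod

namespace SMod0

variable {L : GLSA}

/-- A (graded) sub-supermodule of a `𝔤₀̄`-supermodule. -/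
def IsSubmod (V : SMod0 L) (N : Submodule ℂ V.carrier) : Prop :=
  (∀ (x : L.g0), ∀ v ∈ N, V.act x v ∈ N) ∧ N ≤ (N ⊓ V.ev) ⊔ (N ⊓ V.od)

/-- Simplicity of a `𝔤₀̄`-supermodule. -/
def IsSimple (V : SMod0 L) : Prop :=
  (⊤ : Submodule ℂ V.carrier) ≠ ⊥ ∧ ∀ N, V.IsSubmod N → N = ⊥ ∨ N = ⊤

end SMod0

/-- `IsKac V K η` expresses that `K`, together with the (even, `𝔤₀̄`-equivariant) unit map
`η : V → K` whose image is annihilated by `𝔤₁`, is *the* Kac module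
`K(V) = Ind_{𝔤≥0}^{𝔤} V` of the `𝔤₀̄`-supermodule `V` (on which `𝔤₁` acts by zero), i.e.
satisfies the universal property `Hom_𝔤(K(V), M) = Hom_{𝔤₀̄}(V, M^{𝔤₁})`. -/
structure IsKac {L : GLSA} (V : SMod0 L) (K : SMod L) (η : V.carrier →ₗ[ℂ] K.carrier) : Prop where
  map_ev : ∀ v ∈ V.ev, η v ∈ K.ev
  map_od : ∀ v ∈ V.od, η v ∈ K.od
  equivar : ∀ (x : L.g0) (v : V.carrier), η (V.act x v) = K.act ↑x (η v)
  pos_zero : ∀ x ∈ L.gpos, ∀ v : V.carrier, K.act x (η v) = 0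
  injective : Injective η
  generates : K.gen (LinearMap.range η) = ⊤
  universal : ∀ (M : SMod L) (φ : V.carrier →ₗ[ℂ] M.carrier),
    (∀ v ∈ V.ev, φ v ∈ M.ev) → (∀ v ∈ V.od, φ v ∈ M.od) →
    (∀ (x : L.g0) (v : V.carrier), φ (V.act x v) = M.act ↑x (φ v)) →
    (∀ x ∈ L.gpos, ∀ v : V.carrier, M.act x (φ v) = 0) →
    ∃! Φ : SHom K M, ∀ v, Φ.toLin (η v) = φ v

/-- The opposite Kac module `K'(V) = Ind_{𝔤≤0}^{𝔤} V` (with `𝔤₋₁` acting by zero on `V`),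
described by its universal property. -/
structure IsKac' {L : GLSA} (V : SMod0 L) (K : SMod L) (η : V.carrier →ₗ[ℂ] K.carrier) : Prop where
  map_ev : ∀ v ∈ V.ev, η v ∈ K.ev
  map_od : ∀ v ∈ V.od, η v ∈ K.od
  equivar : ∀ (x : L.g0) (v : V.carrier), η (V.act x v) = K.act ↑x (η v)
  neg_zero : ∀ x ∈ L.gneg, ∀ v : V.carrier, K.act x (η v) = 0
  injective : Injective η
  generates : K.gen (LinearMap.range η) = ⊤
  universal : ∀ (M : SMod L) (φ : V.carrier →ₗ[ℂ] M.carrier),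
    (∀ v ∈ V.ev, φ v ∈ M.ev) → (∀ v ∈ V.od, φ v ∈ M.od) →
    (∀ (x : L.g0) (v : V.carrier), φ (V.act x v) = M.act ↑x (φ v)) →
    (∀ x ∈ L.gneg, ∀ v : V.carrier, M.act x (φ v) = 0) →
    ∃! Φ : SHom K M, ∀ v, Φ.toLin (η v) = φ v

/-- `IsCoindPos W C ε` expresses that `C`, together with the (even, `𝔤₀̄`-equivariant)
counit `ε : C → W` killing `𝔤₁·C`, is the coinduced module `Coind_{𝔤≥0}^{𝔤}(W)` of the
`𝔤₀̄`-supermodule `W` (with `𝔤₁` acting by zero), i.e. satisfies the universal property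
`Hom_𝔤(M, Coind(W)) = Hom_{𝔤≥0}(Res M, W)`. -/
structure IsCoindPos {L : GLSA} (W : SMod0 L) (C : SMod L) (ε : C.carrier →ₗ[ℂ] W.carrier) : Prop where
  map_ev : ∀ c ∈ C.ev, ε c ∈ W.ev
  map_od : ∀ c ∈ C.od, ε c ∈ W.od
  equivar : ∀ (x : L.g0) (c : C.carrier), ε (C.act ↑x c) = W.act x (ε c)
  pos_zero : ∀ x ∈ L.gpos, ∀ c : C.carrier, ε (C.act x c) = 0
  universal : ∀ (M : SMod L) (ψ : M.carrier →ₗ[ℂ] W.carrier),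
    (∀ m ∈ M.ev, ψ m ∈ W.ev) → (∀ m ∈ M.od, ψ m ∈ W.od) →
    (∀ (x : L.g0) (m : M.carrier), ψ (M.act ↑x m) = W.act x (ψ m)) →
    (∀ x ∈ L.gpos, ∀ m : M.carrier, ψ (M.act x m) = 0) →
    ∃! Φ : SHom M C, ∀ m, ε (Φ.toLin m) = ψ m

/-- `Coind_{𝔤≤0}^{𝔤}(W)`, by its universal property. -/
structure IsCoindNeg {L : GLSA} (W : SMod0 L) (C : SMod L) (ε : C.carrier →ₗ[ℂ] W.carrier) : Prop where
  map_ev : ∀ c ∈ C.ev, ε c ∈ W.ev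
  map_od : ∀ c ∈ C.od, ε c ∈ W.od
  equivar : ∀ (x : L.g0) (c : C.carrier), ε (C.act ↑x c) = W.act x (ε c)
  neg_zero : ∀ x ∈ L.gneg, ∀ c : C.carrier, ε (C.act x c) = 0
  universal : ∀ (M : SMod L) (ψ : M.carrier →ₗ[ℂ] W.carrier),
    (∀ m ∈ M.ev, ψ m ∈ W.ev) → (∀ m ∈ M.od, ψ m ∈ W.od) →
    (∀ (x : L.g0) (m : M.carrier), ψ (M.act ↑x m) = W.act x (ψ m)) →
    (∀ x ∈ L.gneg, ∀ m : M.carrier, ψ (M.act x m) = 0) →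
    ∃! Φ : SHom M C, ∀ m, ε (Φ.toLin m) = ψ m

/-- The subspace `Λ^max(𝔤₋₁) ⊗ V ⊆ K(V)`: the span of all elements obtained by acting on
`η(V)` with `dim 𝔤₋₁` many elements of `𝔤₋₁`. -/
def botPartNeg {L : GLSA} (V : SMod0 L) (K : SMod L) (η : V.carrier →ₗ[ℂ] K.carrier) :
    Submodule ℂ K.carrier :=
  Submodule.span ℂ {m | ∃ (xs : List L.carrier) (v : V.carrier),
    xs.length = finrank ℂ ↥L.gneg ∧ (∀ x ∈ xs, x ∈ L.gneg) ∧ m = K.actList xs (η v)}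

/-- The subspace `Λ^max(𝔤₁) ⊗ V ⊆ K'(V)`. -/
def botPartPos {L : GLSA} (V : SMod0 L) (K : SMod L) (η : V.carrier →ₗ[ℂ] K.carrier) :
    Submodule ℂ K.carrier :=
  Submodule.span ℂ {m | ∃ (xs : List L.carrier) (v : V.carrier),
    xs.length = finrank ℂ ↥L.gpos ∧ (∀ x ∈ xs, x ∈ L.gpos) ∧ m = K.actList xs (η v)}

/-- For `x ∈ 𝔤₀̄`, the operator `ad x` restricted to `𝔤₁`. -/
def adPos (L : GLSA) (x : L.g0) : ↥L.gpos →ₗ[ℂ] ↥L.gpos :=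
  (L.bracket ↑x).restrict (fun y hy => L.br_0p ↑x x.2 y hy)

/-- For `x ∈ 𝔤₀̄`, the operator `ad x` restricted to `𝔤₋₁`. -/
def adNeg (L : GLSA) (x : L.g0) : ↥L.gneg →ₗ[ℂ] ↥L.gneg :=
  (L.bracket ↑x).restrict (fun y hy => L.br_0n ↑x x.2 y hy)

/-- The character by which `𝔤₀̄` acts on the one-dimensional module `Λ^max(𝔤₁)`. -/
def traceCharPos (L : GLSA) (x : L.g0) : ℂ := LinearMap.trace ℂ ↥L.gpos (adPos L x)

/-- The character by which `𝔤₀̄` acts on the one-dimensional module `Λ^max(𝔤₋₁)`. -/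
def traceCharNeg (L : GLSA) (x : L.g0) : ℂ := LinearMap.trace ℂ ↥L.gneg (adNeg L x)

/-- `IsTwistBy V W χ swap` expresses that `W ≅ ℂ_χ ⊗ V` as `𝔤₀̄`-supermodules, where `ℂ_χ`
is the one-dimensional module with character `χ`, of odd parity iff `swap = true`.
Taking `χ` to be `traceCharPos`/`traceCharNeg` (resp. their negatives) and `swap` the parity
of `dim 𝔤±₁` expresses `W ≅ Λ^max(𝔤±₁) ⊗ V` (resp. `W ≅ Λ^max(𝔤±₁^*) ⊗ V`). -/
def IsTwistBy {L : GLSA} (V W : SMod0 L) (χ : ↥L.g0 → ℂ) (swap : Bool) : Prop :=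
  ∃ e : V.carrier ≃ₗ[ℂ] W.carrier,
    (∀ (x : L.g0) (v : V.carrier), W.act x (e v) = e (V.act x v) + χ x • e v) ∧
    (if swap then (∀ v ∈ V.ev, e v ∈ W.od) ∧ (∀ v ∈ V.od, e v ∈ W.ev)
     else (∀ v ∈ V.ev, e v ∈ W.ev) ∧ (∀ v ∈ V.od, e v ∈ W.od))

/-- Parity (as a `Bool`) of `dim 𝔤₁`. -/
def parPos (L : GLSA) : Bool := (finrank ℂ ↥L.gpos) % 2 == 1

/-- Parity (as a `Bool`) of `dim 𝔤₋₁`. -/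
def parNeg (L : GLSA) : Bool := (finrank ℂ ↥L.gneg) % 2 == 1


open scoped TensorProduct

section ExteriorAction

variable {k E M : Type*} [Field k] [AddCommGroup E] [Module k E] [AddCommGroup M] [Module k M]

theorem anticomm_of_sq_zero {m : E →ₗ[k] End k M} (hm : ∀ x p, m x (m x p) = 0) (x y : E) (p : M) :
    m x (m y p) = -m y (m x p) := by
  have h := hm (x + y) p
  simp only [map_add, LinearMap.add_apply, hm, zero_add, add_zero] at h
  exact eq_neg_of_add_eq_zero_right h

/-- A product of more than `dim E` square-zero operators depending linearly on `E` vanishes. -/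
theorem foldr_eq_zero_of_finrank_lt [FiniteDimensional k E] {m : E →ₗ[k] End k M}
    (hm : ∀ x p, m x (m x p) = 0) (xs : List E) (h : finrank k E < xs.length) (p : M) :
    xs.foldr (fun x q => m x q) p = 0 := by
  have hm' : ∀ x, m x * m x = 0 := fun x => LinearMap.ext fun p => hm x p
  have h1 : (xs.map (ExteriorAlgebra.ι k)).prod = 0 := by
    have h2 : ¬ LinearIndependent k xs.get := fun h3 => by
      have := h3.fintype_card_le_finrank
      simp at this
      omega
    have h3 := (ExteriorAlgebra.ιMulti k xs.length).map_linearDependent xs.get h2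
    rw [ExteriorAlgebra.ιMulti_apply] at h3
    rw [← h3]
    congr 1
    apply List.ext_get <;> simp
  have h2 : ∀ ys : List E, ExteriorAlgebra.lift k ⟨m, hm'⟩ (ys.map (ExteriorAlgebra.ι k)).prod p =
      ys.foldr (fun x q => m x q) p := by
    intro ys
    induction ys with
    | nil => simp
    | cons y ys ih => simp [← ih]
  rw [← h2, h1]
  simp

/-- A nonzero stable subspace contains a nonzero invariant vector. -/
theorem exists_invariant_mem [FiniteDimensional k E] {m : E →ₗ[k] End k M}
    (hm : ∀ x p, m x (m x p) = 0) (N : Submodule k M) (hN : ∀ x, ∀ p ∈ N, m x p ∈ N)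
    (hne : N ≠ ⊥) : ∃ p ∈ N, p ≠ 0 ∧ ∀ x, m x p = 0 := by
  have key : ∀ l : List E, ∃ p ∈ N, p ≠ 0 ∧ ∀ x ∈ l, m x p = 0 := by
    intro l
    induction l with
    | nil =>
      obtain ⟨p, hp, hp0⟩ := N.exists_mem_ne_zero_of_ne_bot hne
      exact ⟨p, hp, hp0, by simp⟩
    | cons x l ih =>
      obtain ⟨p, hp, hp0, hl⟩ := ih
      by_cases hx : m x p = 0
      · exact ⟨p, hp, hp0, by simpa [hx] using hl⟩
      · refine ⟨m x p, hN x p hp, hx, ?_⟩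
        intro y hy
        rcases List.mem_cons.1 hy with rfl | hy
        · exact hm _ _
        · rw [anticomm_of_sq_zero hm, hl y hy, map_zero, neg_zero]
  let b := finBasis k E
  obtain ⟨p, hp, hp0, hl⟩ := key ((List.finRange _).map b)
  refine ⟨p, hp, hp0, fun x => ?_⟩
  have : m.flip p = 0 := b.ext fun i => by simpa using hl (b i) (by simp)
  exact LinearMap.congr_fun this x

/-- If the operators `m x` admit contractions, every invariant vector is the image of a product of
`dim E` of them. -/
theorem exists_eq_foldr_of_invariant [FiniteDimensional k E] {m : E →ₗ[k] End k M}
    (hd : ∀ φ : Dual k E, ∃ d : End k M, ∀ x p, d (m x p) = φ x • p - m x (d p))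
    (p : M) (hp : ∀ x, m x p = 0) :
    ∃ xs : List E, xs.length = finrank k E ∧ ∃ q, p = xs.foldr (fun x q => m x q) q := by
  let b := finBasis k E
  have pass : ∀ (φ : Dual k E) (d : End k M), (∀ x p, d (m x p) = φ x • p - m x (d p)) →
      ∀ (xs : List E), (∀ x ∈ xs, φ x = 0) → ∀ q, ∃ q',
        d (xs.foldr (fun x q => m x q) q) = xs.foldr (fun x q => m x q) q' := by
    intro φ d hφ xs hxs q
    suffices h : ∃ c : k, d (xs.foldr (fun x q => m x q) q) =
        xs.foldr (fun x q => m x q) (c • d q) from ⟨_, h.choose_spec⟩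
    have hsmul : ∀ (ys : List E) (c : k) (q : M), ys.foldr (fun x q => m x q) (c • q) =
        c • ys.foldr (fun x q => m x q) q := by
      intro ys c q
      induction ys with
      | nil => rfl
      | cons y ys ih => simp [ih]
    induction xs with
    | nil => exact ⟨1, by simp⟩
    | cons x xs ih =>
      obtain ⟨c, hc⟩ := ih fun y hy => hxs y (List.mem_cons_of_mem _ hy)
      refine ⟨-c, ?_⟩
      simp only [List.foldr_cons, hφ, hxs x List.mem_cons_self, hc, hsmul]
      simp
  have key : ∀ l : List (Fin (finrank k E)), l.Nodup →
      ∃ q, p = (l.map b).foldr (fun x q => m x q) q := by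
    intro l
    induction l with
    | nil => exact fun _ => ⟨p, rfl⟩
    | cons i l ih =>
      intro hl
      rw [List.nodup_cons] at hl
      obtain ⟨q, hq⟩ := ih hl.2
      obtain ⟨d, hd⟩ := hd (b.coord i)
      obtain ⟨q', hq'⟩ := pass (b.coord i) d hd (l.map b) (by
        intro x hx
        obtain ⟨j, hj, rfl⟩ := List.mem_map.1 hx
        have : j ≠ i := fun h => hl.1 (h ▸ hj)
        simp [this]) q
      refine ⟨q', ?_⟩
      have h := hd (b i) p
      rw [hp, map_zero] at h
      simp only [Basis.coord_apply, Basis.repr_self, Finsupp.single_eq_same, one_smul] at h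
      rw [List.map_cons, List.foldr_cons, ← hq', ← hq]
      exact sub_eq_zero.1 h.symm
  obtain ⟨q, hq⟩ := key (List.finRange _) (List.nodup_finRange _)
  exact ⟨_, by simp, q, hq⟩

end ExteriorAction

section ExteriorTensor

variable {k E V N G : Type*} [Field k] [AddCommGroup E] [Module k E] [AddCommGroup V] [Module k V]
  [AddCommGroup N] [Module k N] [AddCommGroup G] [Module k G]

variable (k E V) in
/-- Left multiplication by vectors of `E` on `Λ(E) ⊗ V`. -/
def extMul : E →ₗ[k] End k (ExteriorAlgebra k E ⊗[k] V) :=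
  LinearMap.rTensorHom V ∘ₗ LinearMap.mul k (ExteriorAlgebra k E) ∘ₗ ExteriorAlgebra.ι k

variable (k E V) in
/-- The inclusion of `V` in `Λ(E) ⊗ V`. -/
def extUnit : V →ₗ[k] ExteriorAlgebra k E ⊗[k] V := TensorProduct.mk k _ V 1

theorem extMul_tmul (x : E) (w : ExteriorAlgebra k E) (v : V) :
    extMul k E V x (w ⊗ₜ v) = (ExteriorAlgebra.ι k x * w) ⊗ₜ v := rfl

theorem extMul_extMul (x : E) (p : ExteriorAlgebra k E ⊗[k] V) :
    extMul k E V x (extMul k E V x p) = 0 := by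
  induction p using TensorProduct.induction_on with
  | zero => simp
  | tmul w v => simp [extMul_tmul, ← mul_assoc]
  | add p q hp hq => simp [hp, hq]

theorem ext_induction {C : ExteriorAlgebra k E ⊗[k] V → Prop}
    (add : ∀ p q, C p → C q → C (p + q)) (unit : ∀ v, C (extUnit k E V v))
    (mul : ∀ x p, C p → C (extMul k E V x p)) (p : ExteriorAlgebra k E ⊗[k] V) : C p := by
  induction p using TensorProduct.induction_on with
  | zero => simpa using unit 0
  | add p q hp hq => exact add p q hp hq
  | tmul w v =>
    induction w using CliffordAlgebra.left_induction with
    | algebraMap r =>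
      rw [Algebra.algebraMap_eq_smul_one, TensorProduct.smul_tmul]
      exact unit _
    | add p q hp hq => rw [TensorProduct.add_tmul]; exact add _ _ hp hq
    | ι_mul w x h => exact mul x _ h

theorem ext_hom_ext {F F' : ExteriorAlgebra k E ⊗[k] V →ₗ[k] N}
    (unit : ∀ v, F (extUnit k E V v) = F' (extUnit k E V v))
    (mul : ∀ x p, F p = F' p → F (extMul k E V x p) = F' (extMul k E V x p)) : F = F' :=
  LinearMap.ext <| ext_induction (fun p q hp hq => by simp [hp, hq]) unit mul

/-- Primitive recursion on `Λ(E) ⊗ V`. -/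
theorem exists_ext_rec (n₀ : V →ₗ[k] N) (a : E →ₗ[k] ExteriorAlgebra k E ⊗[k] V →ₗ[k] N)
    (b : E →ₗ[k] End k N) (hab : ∀ x p, a x (extMul k E V x p) + b x (a x p) = 0)
    (hb : ∀ x n, b x (b x n) = 0) :
    ∃ F : ExteriorAlgebra k E ⊗[k] V →ₗ[k] N, (∀ v, F (extUnit k E V v) = n₀ v) ∧
      ∀ x p, F (extMul k E V x p) = a x p + b x (F p) := by
  let f : E →ₗ[k] ExteriorAlgebra k E × (V →ₗ[k] N) →ₗ[k] (V →ₗ[k] N) :=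
    { toFun x := (TensorProduct.curry (a x)).coprod ((b x).compRight k)
      map_add' x y := by ext <;> simp
      map_smul' c x := by ext <;> simp }
  have hf : ∀ x w g, f x (ExteriorAlgebra.ι k x * w, f x (w, g)) = (0 : QuadraticForm k E) x • g := by
    intro x w g
    ext v
    have := hab x (w ⊗ₜ v)
    rw [extMul_tmul] at this
    simp [f, hb, this]
  let F := CliffordAlgebra.foldr' (0 : QuadraticForm k E) f hf n₀
  refine ⟨TensorProduct.lift F, fun v => ?_, fun x p => ?_⟩
  · have : F 1 = n₀ := by
      have := CliffordAlgebra.foldr'_algebraMap (0 : QuadraticForm k E) f hf n₀ 1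
      simpa using this
    simp [extUnit, this]
  · induction p using TensorProduct.induction_on with
    | zero => simp
    | add p q hp hq => simp only [map_add, hp, hq]; abel
    | tmul w v =>
      rw [extMul_tmul, TensorProduct.lift.tmul, TensorProduct.lift.tmul]
      exact LinearMap.congr_fun (CliffordAlgebra.foldr'_ι_mul (0 : QuadraticForm k E) f hf n₀ x w) v

/-- Primitive recursion on `Λ(E) ⊗ V`, linear in a parameter. -/
theorem exists_ext_rec_param (n₀ : G →ₗ[k] V →ₗ[k] N)
    (a : G →ₗ[k] E →ₗ[k] ExteriorAlgebra k E ⊗[k] V →ₗ[k] N)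
    (b : E →ₗ[k] End k N) (hab : ∀ g x p, a g x (extMul k E V x p) + b x (a g x p) = 0)
    (hb : ∀ x n, b x (b x n) = 0) :
    ∃ F : G →ₗ[k] ExteriorAlgebra k E ⊗[k] V →ₗ[k] N, (∀ g v, F g (extUnit k E V v) = n₀ g v) ∧
      ∀ g x p, F g (extMul k E V x p) = a g x p + b x (F g p) := by
  choose F hF1 hF2 using fun g => exists_ext_rec (n₀ g) (a g) b (hab g) hb
  refine ⟨{ toFun := F, map_add' := ?_, map_smul' := ?_ }, hF1, hF2⟩
  · refine fun g h => ext_hom_ext (fun v => by simp [hF1]) fun x p hp => ?_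
    simp only [LinearMap.add_apply] at hp
    simp only [LinearMap.add_apply, hF2, hp, map_add]
    abel
  · refine fun c h => ext_hom_ext (fun v => by simp [hF1]) fun x p hp => ?_
    simp only [LinearMap.smul_apply, RingHom.id_apply] at hp
    simp only [LinearMap.smul_apply, hF2, hp, map_smul, smul_add, RingHom.id_apply]

/-- Contractions on `Λ(E) ⊗ V`. -/
theorem exists_ext_contraction (φ : Dual k E) : ∃ d : End k (ExteriorAlgebra k E ⊗[k] V),
    ∀ x p, d (extMul k E V x p) = φ x • p - extMul k E V x (d p) := by
  obtain ⟨d, -, hd⟩ := exists_ext_rec (k := k) (E := E) (V := V) 0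
    (φ.smulRight (LinearMap.id : End k (ExteriorAlgebra k E ⊗[k] V)))
    ((-1 : k) • extMul k E V) (fun x p => by simp) (fun x p => by simp [extMul_extMul])
  exact ⟨d, fun x p => by simp [hd, sub_eq_add_neg]⟩

end ExteriorTensor

theorem eq_zero_of_add_self {M : Type*} [AddCommGroup M] [Module ℂ M] {m : M} (h : m + m = 0) :
    m = 0 := by
  rw [← two_smul ℂ] at h
  simpa using h

namespace GLSA

variable (L : GLSA)

/-- The bracket `𝔤₀ × 𝔤₀ → 𝔤₀`. -/
def br00 (h k : L.g0) : L.g0 := ⟨L.bracket h k, L.br_00 h h.2 k k.2⟩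

/-- The bracket `𝔤₀ × 𝔤₋₁ → 𝔤₋₁`. -/
def br0n : L.g0 →ₗ[ℂ] L.gneg →ₗ[ℂ] L.gneg :=
  LinearMap.mk₂ ℂ (fun h x => ⟨L.bracket h x, L.br_0n h h.2 x x.2⟩)
    (fun _ _ _ => Subtype.ext (by simp)) (fun _ _ _ => Subtype.ext (by simp))
    (fun _ _ _ => Subtype.ext (by simp)) (fun _ _ _ => Subtype.ext (by simp))

/-- The bracket `𝔤₀ × 𝔤₁ → 𝔤₁`. -/
def br0p : L.g0 →ₗ[ℂ] L.gpos →ₗ[ℂ] L.gpos :=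
  LinearMap.mk₂ ℂ (fun h y => ⟨L.bracket h y, L.br_0p h h.2 y y.2⟩)
    (fun _ _ _ => Subtype.ext (by simp)) (fun _ _ _ => Subtype.ext (by simp))
    (fun _ _ _ => Subtype.ext (by simp)) (fun _ _ _ => Subtype.ext (by simp))

/-- The bracket `𝔤₁ × 𝔤₋₁ → 𝔤₀`. -/
def brpn : L.gpos →ₗ[ℂ] L.gneg →ₗ[ℂ] L.g0 :=
  LinearMap.mk₂ ℂ (fun y x => ⟨L.bracket y x, L.br_pn y y.2 x x.2⟩)
    (fun _ _ _ => Subtype.ext (by simp)) (fun _ _ _ => Subtype.ext (by simp))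
    (fun _ _ _ => Subtype.ext (by simp)) (fun _ _ _ => Subtype.ext (by simp))

@[simp] theorem coe_br00 (h h' : L.g0) : (L.br00 h h' : L.carrier) = L.bracket h h' := rfl
@[simp] theorem coe_br0n (h : L.g0) (x : L.gneg) : (L.br0n h x : L.carrier) = L.bracket h x := rfl
@[simp] theorem coe_br0p (h : L.g0) (y : L.gpos) : (L.br0p h y : L.carrier) = L.bracket h y := rfl
@[simp] theorem coe_brpn (y : L.gpos) (x : L.gneg) : (L.brpn y x : L.carrier) = L.bracket y x := rfl

variable {L}

theorem neg_mem_odd (x : L.gneg) : (x : L.carrier) ∈ L.odd := Submodule.mem_sup_left x.2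

theorem pos_mem_odd (y : L.gpos) : (y : L.carrier) ∈ L.odd := Submodule.mem_sup_right y.2

theorem br0n_br00 (h h' : L.g0) (x : L.gneg) :
    L.br0n (L.br00 h h') x = L.br0n h (L.br0n h' x) - L.br0n h' (L.br0n h x) :=
  Subtype.ext (eq_sub_of_add_eq (L.jacobi_e h h' x (Or.inl h.2)).symm)

theorem br00_brpn (h : L.g0) (y : L.gpos) (x : L.gneg) :
    L.br00 h (L.brpn y x) = L.brpn (L.br0p h y) x + L.brpn y (L.br0n h x) :=
  Subtype.ext (L.jacobi_e h y x (Or.inl h.2))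

theorem br0n_brpn_self (y : L.gpos) (x : L.gneg) : L.br0n (L.brpn y x) x = 0 := by
  apply Subtype.ext
  have h1 := L.jacobi_oo x (neg_mem_odd x) x (neg_mem_odd x) y
  rw [L.br_nn x x.2 x x.2, map_zero, LinearMap.zero_apply, zero_sub, eq_neg_iff_add_eq_zero,
    L.skew_oo x (neg_mem_odd x) y (pos_mem_odd y)] at h1
  replace h1 := eq_zero_of_add_self h1
  change L.bracket (L.bracket y x) x = 0
  rw [L.skew_e _ (L.br_pn y y.2 x x.2), h1, neg_zero]

theorem br0p_brpn (y y' : L.gpos) (x : L.gneg) :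
    L.br0p (L.brpn y' x) y + L.br0p (L.brpn y x) y' = 0 := by
  apply Subtype.ext
  have h1 := L.jacobi_oo y (pos_mem_odd y) y' (pos_mem_odd y') x
  rw [L.br_pp y y.2 y' y'.2, map_zero, LinearMap.zero_apply, zero_sub] at h1
  change L.bracket (L.bracket y' x) y + L.bracket (L.bracket y x) y' = 0
  rw [L.skew_e _ (L.br_pn y y.2 x x.2), L.skew_e _ (L.br_pn y' y'.2 x x.2), h1]
  simp

variable (L) in
/-- The projection of `𝔤` onto `𝔤₀`. -/
def pr0 : L.carrier →ₗ[ℂ] L.g0 := Submodule.projectionOnto _ _ L.oddCompl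

variable (L) in
theorem isCompl_neg : IsCompl L.gneg (L.gpos ⊔ L.g0) :=
  L.disjNP.isCompl_sup_right_of_isCompl_sup_left L.oddCompl.symm

variable (L) in
theorem isCompl_pos : IsCompl L.gpos (L.gneg ⊔ L.g0) :=
  L.disjNP.symm.isCompl_sup_right_of_isCompl_sup_left (sup_comm L.gneg L.gpos ▸ L.oddCompl.symm)

variable (L) in
/-- The projection of `𝔤` onto `𝔤₋₁`. -/
def prn : L.carrier →ₗ[ℂ] L.gneg := Submodule.projectionOnto _ _ L.isCompl_neg

variable (L) in
/-- The projection of `𝔤` onto `𝔤₁`. -/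
def prp : L.carrier →ₗ[ℂ] L.gpos := Submodule.projectionOnto _ _ L.isCompl_pos

@[simp] theorem pr0_g0 (h : L.g0) : L.pr0 h = h := Submodule.projectionOnto_apply_left _ h
@[simp] theorem prn_gneg (x : L.gneg) : L.prn x = x := Submodule.projectionOnto_apply_left _ x
@[simp] theorem prp_gpos (y : L.gpos) : L.prp y = y := Submodule.projectionOnto_apply_left _ y
@[simp] theorem pr0_gneg (x : L.gneg) : L.pr0 x = 0 :=
  (Submodule.projectionOnto_apply_eq_zero_iff _).2 (Submodule.mem_sup_left x.2)
@[simp] theorem pr0_gpos (y : L.gpos) : L.pr0 y = 0 :=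
  (Submodule.projectionOnto_apply_eq_zero_iff _).2 (Submodule.mem_sup_right y.2)
@[simp] theorem prn_g0 (h : L.g0) : L.prn h = 0 :=
  (Submodule.projectionOnto_apply_eq_zero_iff _).2 (Submodule.mem_sup_right h.2)
@[simp] theorem prn_gpos (y : L.gpos) : L.prn y = 0 :=
  (Submodule.projectionOnto_apply_eq_zero_iff _).2 (Submodule.mem_sup_left y.2)
@[simp] theorem prp_g0 (h : L.g0) : L.prp h = 0 :=
  (Submodule.projectionOnto_apply_eq_zero_iff _).2 (Submodule.mem_sup_right h.2)
@[simp] theorem prp_gneg (x : L.gneg) : L.prp x = 0 :=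
  (Submodule.projectionOnto_apply_eq_zero_iff _).2 (Submodule.mem_sup_left x.2)

theorem exists_decomp_odd {z : L.carrier} (hz : z ∈ L.odd) :
    ∃ (x : L.gneg) (y : L.gpos), z = x + y := by
  obtain ⟨x, hx, y, hy, h⟩ := Submodule.mem_sup.1 hz
  exact ⟨⟨x, hx⟩, ⟨y, hy⟩, h.symm⟩

theorem exists_decomp (z : L.carrier) :
    ∃ (h : L.g0) (x : L.gneg) (y : L.gpos), z = h + (x + y) := by
  have hz : z ∈ L.g0 ⊔ L.odd := by
    rw [show L.g0 ⊔ L.odd = ⊤ from L.oddCompl.sup_eq_top]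
    trivial
  obtain ⟨h, hh, w, hw, hz⟩ := Submodule.mem_sup.1 hz
  obtain ⟨x, y, rfl⟩ := exists_decomp_odd hw
  exact ⟨⟨h, hh⟩, x, y, hz.symm⟩

end GLSA

open GLSA

section KacModel

variable {L : GLSA} (V : SMod0 L)

/-- The underlying space `Λ(𝔤₋₁) ⊗ V` of the Kac module. -/
abbrev KacSpace : Type := ExteriorAlgebra ℂ L.gneg ⊗[ℂ] V.carrier

/-- The action of `𝔤₋₁` on `Λ(𝔤₋₁) ⊗ V`. -/
abbrev kacNeg : L.gneg →ₗ[ℂ] End ℂ (KacSpace V) := extMul ℂ L.gneg V.carrier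

/-- The inclusion of `V` in `Λ(𝔤₋₁) ⊗ V`. -/
abbrev kacUnit : V.carrier →ₗ[ℂ] KacSpace V := extUnit ℂ L.gneg V.carrier

theorem exists_kacZero : ∃ H : L.g0 →ₗ[ℂ] End ℂ (KacSpace V),
    (∀ h v, H h (kacUnit V v) = kacUnit V (V.act h v)) ∧
    ∀ h x p, H h (kacNeg V x p) = kacNeg V (L.br0n h x) p + kacNeg V x (H h p) :=
  exists_ext_rec_param (N := KacSpace V) (V.act.compr₂ (kacUnit V))
    (L.br0n.compr₂ (kacNeg V)) (kacNeg V)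
    (fun h x p => by
      simp [anticomm_of_sq_zero extMul_extMul (L.br0n h x) x])
    extMul_extMul

/-- The action of `𝔤₀` on `Λ(𝔤₋₁) ⊗ V`. -/
def kacZero : L.g0 →ₗ[ℂ] End ℂ (KacSpace V) := (exists_kacZero V).choose

theorem kacZero_unit (h : L.g0) (v : V.carrier) :
    kacZero V h (kacUnit V v) = kacUnit V (V.act h v) := (exists_kacZero V).choose_spec.1 h v

theorem kacZero_neg (h : L.g0) (x : L.gneg) (p : KacSpace V) :
    kacZero V h (kacNeg V x p) = kacNeg V (L.br0n h x) p + kacNeg V x (kacZero V h p) :=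
  (exists_kacZero V).choose_spec.2 h x p

theorem exists_kacPos : ∃ Y : L.gpos →ₗ[ℂ] End ℂ (KacSpace V),
    (∀ y v, Y y (kacUnit V v) = 0) ∧
    ∀ y x p, Y y (kacNeg V x p) = kacZero V (L.brpn y x) p + ((-1 : ℂ) • kacNeg V) x (Y y p) :=
  exists_ext_rec_param (N := KacSpace V) 0
    (L.brpn.compr₂ (kacZero V)) ((-1 : ℂ) • kacNeg V)
    (fun y x p => by
      simp [kacZero_neg, br0n_brpn_self])
    (fun x p => by simp [extMul_extMul])

/-- The action of `𝔤₁` on `Λ(𝔤₋₁) ⊗ V`. -/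
def kacPos : L.gpos →ₗ[ℂ] End ℂ (KacSpace V) := (exists_kacPos V).choose

theorem kacPos_unit (y : L.gpos) (v : V.carrier) : kacPos V y (kacUnit V v) = 0 :=
  (exists_kacPos V).choose_spec.1 y v

theorem kacPos_neg (y : L.gpos) (x : L.gneg) (p : KacSpace V) :
    kacPos V y (kacNeg V x p) = kacZero V (L.brpn y x) p - kacNeg V x (kacPos V y p) := by
  rw [sub_eq_add_neg]
  simpa [kacPos] using (exists_kacPos V).choose_spec.2 y x p

theorem kacZero_br00 (h h' : L.g0) (p : KacSpace V) :
    kacZero V (L.br00 h h') p =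
      kacZero V h (kacZero V h' p) - kacZero V h' (kacZero V h p) := by
  induction p using ext_induction with
  | add p q hp hq => simp only [map_add, hp, hq]; abel
  | unit v => simp only [kacZero_unit, ← map_sub]; exact congrArg _ (V.act_br h h' v)
  | mul x p hp =>
    simp only [kacZero_neg, map_add, hp, br0n_br00, map_sub, LinearMap.sub_apply]
    abel

theorem kacPos_br0p (h : L.g0) (y : L.gpos) (p : KacSpace V) :
    kacPos V (L.br0p h y) p =
      kacZero V h (kacPos V y p) - kacPos V y (kacZero V h p) := by
  induction p using ext_induction with
  | add p q hp hq => simp only [map_add, hp, hq]; abel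
  | unit v => simp [kacZero_unit, kacPos_unit]
  | mul x p hp =>
    have h1 := kacZero_br00 V h (L.brpn y x) p
    rw [br00_brpn, map_add, LinearMap.add_apply] at h1
    have h2 := eq_sub_of_add_eq h1
    simp only [kacZero_neg, kacPos_neg, map_add, map_sub, hp, h2]
    abel

theorem kacPos_kacPos (y y' : L.gpos) (p : KacSpace V) :
    kacPos V y (kacPos V y' p) + kacPos V y' (kacPos V y p) = 0 := by
  induction p using ext_induction with
  | add p q hp hq =>
    simp only [map_add]
    rw [add_add_add_comm, hp, hq, add_zero]
  | unit v => simp [kacPos_unit]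
  | mul x p hp =>
    have h1 := kacPos_br0p V (L.brpn y' x) y p
    have h2 := kacPos_br0p V (L.brpn y x) y' p
    have h3 : kacPos V (L.br0p (L.brpn y' x) y) p + kacPos V (L.br0p (L.brpn y x) y') p = 0 := by
      rw [← LinearMap.add_apply, ← map_add, br0p_brpn, map_zero, LinearMap.zero_apply]
    have h4 : kacNeg V x (kacPos V y (kacPos V y' p)) + kacNeg V x (kacPos V y' (kacPos V y p)) = 0 := by
      rw [← map_add, hp, map_zero]
    rw [h1, h2] at h3
    simp only [kacPos_neg, map_sub]
    rw [← neg_eq_zero, ← h3, ← sub_eq_zero, ← neg_eq_zero, ← h4]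
    abel

/-- The parity operator of a `𝔤₀`-supermodule. -/
def SMod0.parity : End ℂ V.carrier :=
  LinearMap.ofIsCompl V.grading V.ev.subtype (-V.od.subtype)

theorem SMod0.parity_ev {v : V.carrier} (hv : v ∈ V.ev) : V.parity v = v :=
  LinearMap.ofIsCompl_apply_left V.grading ⟨v, hv⟩

theorem SMod0.parity_od {v : V.carrier} (hv : v ∈ V.od) : V.parity v = -v :=
  LinearMap.ofIsCompl_apply_right V.grading ⟨v, hv⟩

theorem SMod0.exists_decomp (v : V.carrier) : ∃ a ∈ V.ev, ∃ b ∈ V.od, a + b = v :=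
  Submodule.mem_sup.1 (V.grading.sup_eq_top ▸ Submodule.mem_top)

theorem SMod0.parity_parity (v : V.carrier) : V.parity (V.parity v) = v := by
  obtain ⟨a, ha, b, hb, rfl⟩ := V.exists_decomp v
  simp [V.parity_ev ha, V.parity_od hb]

theorem SMod0.parity_act (h : L.g0) (v : V.carrier) :
    V.parity (V.act h v) = V.act h (V.parity v) := by
  obtain ⟨a, ha, b, hb, rfl⟩ := V.exists_decomp v
  simp [V.parity_ev ha, V.parity_od hb, V.parity_ev (V.act_ev h a ha),
    V.parity_od (V.act_od h b hb)]

theorem exists_kacParity : ∃ s : End ℂ (KacSpace V),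
    (∀ v, s (kacUnit V v) = kacUnit V (V.parity v)) ∧
    ∀ x p, s (kacNeg V x p) = (0 : L.gneg →ₗ[ℂ] End ℂ (KacSpace V)) x p +
      ((-1 : ℂ) • kacNeg V) x (s p) :=
  exists_ext_rec (N := KacSpace V) (kacUnit V ∘ₗ V.parity) 0 ((-1 : ℂ) • kacNeg V)
    (fun x p => by simp) (fun x p => by simp [extMul_extMul])

/-- The parity operator of `Λ(𝔤₋₁) ⊗ V`. -/
def kacParity : End ℂ (KacSpace V) := (exists_kacParity V).choose

theorem kacParity_unit (v : V.carrier) : kacParity V (kacUnit V v) = kacUnit V (V.parity v) :=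
  (exists_kacParity V).choose_spec.1 v

theorem kacParity_neg (x : L.gneg) (p : KacSpace V) :
    kacParity V (kacNeg V x p) = -kacNeg V x (kacParity V p) := by
  simpa [kacParity] using (exists_kacParity V).choose_spec.2 x p

theorem kacParity_kacParity (p : KacSpace V) : kacParity V (kacParity V p) = p := by
  induction p using ext_induction with
  | add p q hp hq => simp only [map_add, hp, hq]
  | unit v => simp only [kacParity_unit, V.parity_parity]
  | mul x p hp => simp only [kacParity_neg, map_neg, hp, neg_neg]

theorem kacParity_zero (h : L.g0) (p : KacSpace V) :
    kacParity V (kacZero V h p) = kacZero V h (kacParity V p) := by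
  induction p using ext_induction with
  | add p q hp hq => simp only [map_add, hp, hq]
  | unit v => simp only [kacParity_unit, kacZero_unit, V.parity_act]
  | mul x p hp => simp only [kacParity_neg, kacZero_neg, map_neg, map_add, hp]; abel

theorem kacParity_pos (y : L.gpos) (p : KacSpace V) :
    kacParity V (kacPos V y p) = -kacPos V y (kacParity V p) := by
  induction p using ext_induction with
  | add p q hp hq => simp only [map_add, hp, hq]; abel
  | unit v => simp [kacParity_unit, kacPos_unit]
  | mul x p hp =>
    simp only [kacParity_neg, kacPos_neg, kacParity_zero, map_neg, map_sub, hp]; abel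

/-- The action of `𝔤` on `Λ(𝔤₋₁) ⊗ V`. -/
def kacAct : L.carrier →ₗ[ℂ] End ℂ (KacSpace V) :=
  kacZero V ∘ₗ L.pr0 + kacNeg V ∘ₗ L.prn + kacPos V ∘ₗ L.prp

@[simp] theorem kacAct_g0 (h : L.g0) : kacAct V h = kacZero V h := by simp [kacAct]
@[simp] theorem kacAct_gneg (x : L.gneg) : kacAct V x = kacNeg V x := by simp [kacAct]
@[simp] theorem kacAct_gpos (y : L.gpos) : kacAct V y = kacPos V y := by simp [kacAct]

theorem kacParity_act_odd {z : L.carrier} (hz : z ∈ L.odd) (p : KacSpace V) :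
    kacParity V (kacAct V z p) = -kacAct V z (kacParity V p) := by
  obtain ⟨x, y, rfl⟩ := exists_decomp_odd hz
  simp [kacParity_neg, kacParity_pos, add_comm]

theorem kacAct_bracket_g0 (h : L.g0) (z : L.carrier) (p : KacSpace V) :
    kacAct V (L.bracket h z) p = kacAct V h (kacAct V z p) - kacAct V z (kacAct V h p) := by
  obtain ⟨h', x, y, rfl⟩ := exists_decomp z
  simp only [map_add, ← coe_br00, ← coe_br0n, ← coe_br0p, kacAct_g0, kacAct_gneg, kacAct_gpos,
    LinearMap.add_apply, kacZero_br00, kacPos_br0p, kacZero_neg]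
  abel

theorem kacAct_bracket_odd {w z : L.carrier} (hw : w ∈ L.odd) (hz : z ∈ L.odd) (p : KacSpace V) :
    kacAct V (L.bracket w z) p = kacAct V w (kacAct V z p) + kacAct V z (kacAct V w p) := by
  obtain ⟨x, y, rfl⟩ := exists_decomp_odd hw
  obtain ⟨x', y', rfl⟩ := exists_decomp_odd hz
  have h1 := kacPos_kacPos V y y' p
  have h2 := anticomm_of_sq_zero (m := kacNeg V) extMul_extMul x x' p
  simp only [map_add, LinearMap.add_apply, L.br_nn x x.2 x' x'.2, L.br_pp y y.2 y' y'.2,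
    L.skew_oo x (neg_mem_odd x) y' (pos_mem_odd y'), ← coe_brpn, kacAct_g0, kacAct_gneg,
    kacAct_gpos, map_zero, LinearMap.zero_apply, kacPos_neg, h2, eq_neg_of_add_eq_zero_left h1]
  abel

/-- The Kac module of `V`, realized on `Λ(𝔤₋₁) ⊗ V`. -/
abbrev kacModel : SMod L where
  carrier := KacSpace V
  act := kacAct V
  ev := LinearMap.eqLocus (kacParity V) LinearMap.id
  od := LinearMap.eqLocus (kacParity V) ((-1 : ℂ) • LinearMap.id)
  grading := by
    constructor
    · rw [Submodule.disjoint_def]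
      intro p h1 h2
      rw [LinearMap.mem_eqLocus] at h1 h2
      rw [h1] at h2
      exact eq_zero_of_add_self (eq_neg_iff_add_eq_zero.1 (by simpa using h2))
    · rw [codisjoint_iff, eq_top_iff]
      intro p _
      refine Submodule.mem_sup.2 ⟨(2⁻¹ : ℂ) • (p + kacParity V p), ?_,
        (2⁻¹ : ℂ) • (p - kacParity V p), ?_, ?_⟩
      · simp [LinearMap.mem_eqLocus, kacParity_kacParity, add_comm]
      · simp only [LinearMap.mem_eqLocus, map_smul, map_sub, kacParity_kacParity,
          LinearMap.smul_apply, LinearMap.id_apply]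
        module
      · module
  act_e_ev h hh p hp := by
    lift h to L.g0 using hh
    rw [LinearMap.mem_eqLocus] at hp ⊢
    simp_all [kacParity_zero]
  act_e_od h hh p hp := by
    lift h to L.g0 using hh
    rw [LinearMap.mem_eqLocus] at hp ⊢
    simp_all [kacParity_zero]
  act_o_ev z hz p hp := by
    rw [LinearMap.mem_eqLocus] at hp ⊢
    simp_all [kacParity_act_odd]
  act_o_od z hz p hp := by
    rw [LinearMap.mem_eqLocus] at hp ⊢
    simp_all [kacParity_act_odd]
  act_br_e w z hwz p := by
    rcases hwz with h | h
    · exact kacAct_bracket_g0 V ⟨w, h⟩ z p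
    · have h1 := kacAct_bracket_g0 V ⟨z, h⟩ w p
      rw [L.skew_e z h w, map_neg, LinearMap.neg_apply] at h1
      rw [← neg_sub, ← h1, neg_neg]
  act_br_oo w hw z hz p := kacAct_bracket_odd V hw hz p

end KacModel

section Comparison

variable {L : GLSA} {V : SMod0 L} {K : SMod L} {η : V.carrier →ₗ[ℂ] K.carrier}

theorem SMod.act_act_gneg (K : SMod L) (x : L.gneg) (m : K.carrier) :
    K.act x (K.act x m) = 0 := by
  have h := K.act_br_oo x (neg_mem_odd x) x (neg_mem_odd x) m
  rw [L.br_nn x x.2 x x.2, map_zero, LinearMap.zero_apply] at h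
  exact eq_zero_of_add_self h.symm

theorem SMod.exists_lift_kacSpace (K : SMod L) (η : V.carrier →ₗ[ℂ] K.carrier) :
    ∃ F : KacSpace V →ₗ[ℂ] K.carrier, (∀ v, F (kacUnit V v) = η v) ∧
      ∀ x p, F (kacNeg V x p) = K.act x (F p) := by
  obtain ⟨F, h1, h2⟩ := exists_ext_rec η 0 (K.act ∘ₗ L.gneg.subtype) (fun x p => by simp)
    K.act_act_gneg
  exact ⟨F, h1, fun x p => by simp [h2]⟩

theorem IsKac.equivariant_of_lift (hK : IsKac V K η) {F : KacSpace V →ₗ[ℂ] K.carrier}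
    (hu : ∀ v, F (kacUnit V v) = η v) (hn : ∀ x p, F (kacNeg V x p) = K.act x (F p))
    (z : L.carrier) (p : KacSpace V) : F (kacAct V z p) = K.act z (F p) := by
  have h0 : ∀ (h : L.g0) p, F (kacZero V h p) = K.act h (F p) := by
    intro h p
    induction p using ext_induction with
    | add p q hp hq => simp only [map_add, hp, hq]
    | unit v => rw [kacZero_unit, hu, hu, hK.equivar]
    | mul x p hp =>
      rw [kacZero_neg, map_add, hn, hn, hn, hp, coe_br0n, K.act_br_e h x (Or.inl h.2),
        sub_add_cancel]
  have h1 : ∀ (y : L.gpos) p, F (kacPos V y p) = K.act y (F p) := by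
    intro y p
    induction p using ext_induction with
    | add p q hp hq => simp only [map_add, hp, hq]
    | unit v => rw [kacPos_unit, hu, hK.pos_zero y y.2, map_zero]
    | mul x p hp =>
      rw [kacPos_neg, map_sub, h0, hn, hn, hp, coe_brpn,
        K.act_br_oo y (pos_mem_odd y) x (neg_mem_odd x), add_sub_cancel_right]
  obtain ⟨h, x, y, rfl⟩ := exists_decomp z
  simp [h0, h1, hn]

theorem IsKac.surjective_of_lift (hK : IsKac V K η) {F : KacSpace V →ₗ[ℂ] K.carrier}
    (hu : ∀ v, F (kacUnit V v) = η v) (hn : ∀ x p, F (kacNeg V x p) = K.act x (F p)) :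
    Surjective F := by
  rw [← LinearMap.range_eq_top, eq_top_iff, ← hK.generates]
  refine sInf_le ⟨⟨?_, ?_⟩, ?_⟩
  · rintro z _ ⟨p, rfl⟩
    exact ⟨kacAct V z p, hK.equivariant_of_lift hu hn z p⟩
  · rintro _ ⟨p, rfl⟩
    induction p using ext_induction with
    | add p q hp hq => rw [map_add]; exact add_mem hp hq
    | unit v =>
      obtain ⟨a, ha, b, hb, rfl⟩ := V.exists_decomp v
      rw [map_add, map_add, hu, hu]
      exact Submodule.add_mem_sup ⟨⟨_, hu a⟩, hK.map_ev a ha⟩ ⟨⟨_, hu b⟩, hK.map_od b hb⟩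
    | mul x p hp =>
      obtain ⟨_, ⟨⟨a, rfl⟩, ha⟩, _, ⟨⟨b, rfl⟩, hb⟩, h⟩ := Submodule.mem_sup.1 hp
      rw [hn, ← h, map_add, add_comm]
      exact Submodule.add_mem_sup ⟨⟨_, hn x b⟩, K.act_o_od x (neg_mem_odd x) _ hb⟩
        ⟨⟨_, hn x a⟩, K.act_o_ev x (neg_mem_odd x) _ ha⟩
  · rintro _ ⟨v, rfl⟩
    exact ⟨_, hu v⟩

theorem IsKac.injective_of_lift (hK : IsKac V K η) {F : KacSpace V →ₗ[ℂ] K.carrier}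
    (hu : ∀ v, F (kacUnit V v) = η v) (hn : ∀ x p, F (kacNeg V x p) = K.act x (F p)) :
    Injective F := by
  have hev : ∀ v ∈ V.ev, kacParity V (kacUnit V v) = kacUnit V v := fun v hv => by
    rw [kacParity_unit, V.parity_ev hv]
  have hod : ∀ v ∈ V.od, kacParity V (kacUnit V v) =
      ((-1 : ℂ) • LinearMap.id : End ℂ (KacSpace V)) (kacUnit V v) := fun v hv => by
    simp [kacParity_unit, V.parity_od hv]
  have h0 : ∀ (h : L.g0) v, kacUnit V (V.act h v) = kacAct V h (kacUnit V v) := fun h v => by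
    rw [kacAct_g0, kacZero_unit]
  have hpos : ∀ y ∈ L.gpos, ∀ v, kacAct V y (kacUnit V v) = 0 := fun y hy v => by
    lift y to L.gpos using hy
    rw [kacAct_gpos, kacPos_unit]
  obtain ⟨Φ, hΦ, -⟩ := hK.universal (kacModel V) (kacUnit V) hev hod h0 hpos
  have h : ∀ p, Φ.toLin (F p) = p := by
    intro p
    induction p using ext_induction with
    | add p q hp hq => rw [map_add, map_add, hp, hq]
    | unit v => rw [hu]; exact hΦ v
    | mul x p hp =>
      rw [hn, Φ.equivar, hp]
      change kacAct V x p = _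
      rw [kacAct_gneg]
  exact LeftInverse.injective h

theorem SMod.actList_map_coe (K : SMod L) (xs : List L.gneg) (m : K.carrier) :
    K.actList (xs.map (↑)) m = xs.foldr (fun x q => (K.act ∘ₗ L.gneg.subtype) x q) m := by
  induction xs with
  | nil => rfl
  | cons x xs ih => exact congrArg (K.act x) ih

theorem IsKac.invNeg_eq_botPartNeg [FiniteDimensional ℂ L.gneg] (hK : IsKac V K η) :
    K.invNeg = botPartNeg V K η := by
  obtain ⟨F, hu, hn⟩ := K.exists_lift_kacSpace η
  let e := LinearEquiv.ofBijective F ⟨hK.injective_of_lift hu hn, hK.surjective_of_lift hu hn⟩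
  apply le_antisymm
  · intro k hk
    obtain ⟨xs, hxs, q, hq⟩ := exists_eq_foldr_of_invariant (m := K.act ∘ₗ L.gneg.subtype)
      (fun φ => by
        obtain ⟨d, hd⟩ := exists_ext_contraction (V := V.carrier) φ
        refine ⟨F ∘ₗ d ∘ₗ e.symm.toLinearMap, fun x k => ?_⟩
        obtain ⟨p, rfl⟩ := e.surjective k
        have h : K.act x (e p) = e (kacNeg V x p) := (hn x p).symm
        simp only [LinearMap.comp_apply, Submodule.subtype_apply, LinearEquiv.coe_coe, h,
          LinearEquiv.symm_apply_apply, hd, map_sub, map_smul, hn]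
        rfl) k (fun x => hk x x.2)
    subst hq
    obtain ⟨p, rfl⟩ := e.surjective q
    clear hk
    induction p using ext_induction with
    | add p q hp hq =>
      have h : ∀ (ys : List L.gneg) (m m' : K.carrier),
          ys.foldr (fun x q => (K.act ∘ₗ L.gneg.subtype) x q) (m + m') =
          ys.foldr (fun x q => (K.act ∘ₗ L.gneg.subtype) x q) m +
          ys.foldr (fun x q => (K.act ∘ₗ L.gneg.subtype) x q) m' := by
        intro ys m m'
        induction ys with
        | nil => rfl
        | cons y ys ih => simp only [List.foldr_cons, ih, map_add]
      rw [map_add, h]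
      exact add_mem hp hq
    | unit v =>
      rw [← K.actList_map_coe]
      refine Submodule.subset_span ⟨xs.map (↑), v, by simpa using hxs, by simp +contextual, ?_⟩
      exact congrArg _ (hu v)
    | mul x p _ =>
      have h : e (kacNeg V x p) = (K.act ∘ₗ L.gneg.subtype) x (e p) := hn x p
      have h2 := foldr_eq_zero_of_finrank_lt (m := K.act ∘ₗ L.gneg.subtype) K.act_act_gneg
        (xs ++ [x]) (by simp [hxs]) (e p)
      rw [List.foldr_append, List.foldr_cons, List.foldr_nil, ← h] at h2
      rw [h2]
      exact zero_mem _
  · refine Submodule.span_le.2 ?_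
    rintro _ ⟨xs, v, hlen, hxs, rfl⟩ x hx
    lift xs to List L.gneg using hxs
    have h2 := foldr_eq_zero_of_finrank_lt (m := K.act ∘ₗ L.gneg.subtype) K.act_act_gneg
      (⟨x, hx⟩ :: xs) (by simp_all) (η v)
    rw [← K.actList_map_coe] at h2
    exact h2

end Comparison

/-- Let `V` be any non-zero `𝔤₀`-supermodule.  Then every non-zero
`𝔤₋₁`-submodule of the Kac module `K(V)` has non-zero intersection with
`Λ^max(𝔤₋₁) ⊗ V`; in particular, the space of `𝔤₋₁`-invariants of `K(V)` equals
`Λ^max(𝔤₋₁) ⊗ V`. -/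
theorem statement_1 (L : GLSA)
    [FiniteDimensional ℂ ↥L.gneg] [FiniteDimensional ℂ ↥L.gpos]
    (V : SMod0 L) (hV : (⊤ : Submodule ℂ V.carrier) ≠ ⊥)
    (K : SMod L) (η : V.carrier →ₗ[ℂ] K.carrier) (hK : IsKac V K η) :
    (∀ N : Submodule ℂ K.carrier,
        (∀ x ∈ L.gneg, ∀ m ∈ N, K.act x m ∈ N) →
        N ≠ ⊥ → N ⊓ botPartNeg V K η ≠ ⊥) ∧
    K.invNeg = botPartNeg V K η := by
  refine ⟨fun N hN hne => ?_, hK.invNeg_eq_botPartNeg⟩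
  obtain ⟨p, hp, hp0, hinv⟩ := exists_invariant_mem (m := K.act ∘ₗ L.gneg.subtype)
    K.act_act_gneg N (fun x => hN x x.2) hne
  rw [← hK.invNeg_eq_botPartNeg]
  exact (Submodule.ne_bot_iff _).2 ⟨p, ⟨hp, fun x hx => hinv ⟨x, hx⟩⟩, hp0⟩
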